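/- Let N and k be positive integers with 2 < k < N, and let p ≥ (k+2)/(k−2). Then there exists a C² function u : ℝ^N → ℝ with u(x) > 0 for every x and P⁺_k(D²u(x)) + u(x)^p = 0 for every x ∈ ℝ^N. In particular, for p = (k+2)/(k−2) and any μ > 0, the function u(x) = C·(μ + |x|²)^{−(k−2)/2} with C = (k(k−2)μ)^{(k−2)/4} is such a positive classical solution. -/

import Mathlib

open scoped BigOperators

/-- The eigenvalues of a symmetric real matrix, listed in nondecreasing order with
multiplicity (junk value `0` if the matrix is not Hermitian). -/
noncomputable def sortedEig {n : ℕ} (A : Matrix (Fin n) (Fin n) ℝ) : Fin n → ℝ :=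
  if h : A.IsHermitian then h.eigenvalues ∘ Tuple.sort h.eigenvalues else 0

/-- `P⁻_k(A)`: the sum of the `k` smallest eigenvalues of `A`. -/
noncomputable def Pminus {n : ℕ} (k : ℕ) (A : Matrix (Fin n) (Fin n) ℝ) : ℝ :=
  ∑ i : Fin n, if (i : ℕ) < k then sortedEig A i else 0

/-- `P⁺_k(A)`: the sum of the `k` largest eigenvalues of `A`. -/
noncomputable def Pplus {n : ℕ} (k : ℕ) (A : Matrix (Fin n) (Fin n) ℝ) : ℝ :=
  ∑ i : Fin n, if n - k ≤ (i : ℕ) then sortedEig A i else 0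

/-- The Hessian matrix `D²u(x)` of `u : ℝ^N → ℝ` at `x`. -/
noncomputable def hessianMatrix {N : ℕ} (u : EuclideanSpace ℝ (Fin N) → ℝ)
    (x : EuclideanSpace ℝ (Fin N)) : Matrix (Fin N) (Fin N) ℝ :=
  fun i j => iteratedFDeriv ℝ 2 u x ![EuclideanSpace.single i 1, EuclideanSpace.single j 1]

/-- `u` is a viscosity supersolution of `F(D²u) + g(u) = 0` in `Ω`. -/
def IsViscositySupersolution {N : ℕ} (F : Matrix (Fin N) (Fin N) ℝ → ℝ) (g : ℝ → ℝ)
    (Ω : Set (EuclideanSpace ℝ (Fin N))) (u : EuclideanSpace ℝ (Fin N) → ℝ) : Prop :=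
  ∀ x₀ ∈ Ω, ∀ φ : EuclideanSpace ℝ (Fin N) → ℝ, ContDiff ℝ 2 φ →
    IsLocalMinOn (fun x => u x - φ x) Ω x₀ →
      F (hessianMatrix φ x₀) + g (u x₀) ≤ 0

/-- `u` is a viscosity subsolution of `F(D²u) + g(u) = 0` in `Ω`. -/
def IsViscositySubsolution {N : ℕ} (F : Matrix (Fin N) (Fin N) ℝ → ℝ) (g : ℝ → ℝ)
    (Ω : Set (EuclideanSpace ℝ (Fin N))) (u : EuclideanSpace ℝ (Fin N) → ℝ) : Prop :=
  ∀ x₀ ∈ Ω, ∀ φ : EuclideanSpace ℝ (Fin N) → ℝ, ContDiff ℝ 2 φ →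
    IsLocalMaxOn (fun x => u x - φ x) Ω x₀ →
      0 ≤ F (hessianMatrix φ x₀) + g (u x₀)

/-- `u` is a viscosity solution of `F(D²u) + g(u) = 0` in `Ω`. -/
def IsViscositySolution {N : ℕ} (F : Matrix (Fin N) (Fin N) ℝ → ℝ) (g : ℝ → ℝ)
    (Ω : Set (EuclideanSpace ℝ (Fin N))) (u : EuclideanSpace ℝ (Fin N) → ℝ) : Prop :=
  IsViscositySubsolution F g Ω u ∧ IsViscositySupersolution F g Ω u


lemma pplus_rank_one {N k : ℕ} (hk : 0 < k) (hkN : k < N) (a b : ℝ) (hb : 0 ≤ b)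
    (x : EuclideanSpace ℝ (Fin N)) (A : Matrix (Fin N) (Fin N) ℝ)
    (hA : ∀ i j, A i j = a * (if i = j then 1 else 0) + b * (x i * x j)) :
    Pplus k A = k * a + b * ‖x‖ ^ 2 := by
  have hH : A.IsHermitian := by
    ext i j
    simp only [Matrix.conjTranspose_apply, star_trivial, hA]
    by_cases h : i = j
    · subst h; rfl
    · rw [if_neg h, if_neg (fun h' => h h'.symm)]; ring
  set c := b * ‖x‖ ^ 2 with hc
  have hc0 : 0 ≤ c := by positivity
  have hnorm : ‖x‖ ^ 2 = ∑ i, x i * x i := by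
    rw [EuclideanSpace.norm_sq_eq]
    refine Finset.sum_congr rfl fun i _ => ?_
    rw [Real.norm_eq_abs, sq_abs, sq]
  have hval : ∀ i, hH.eigenvalues i = a ∨ hH.eigenvalues i = a + c := by
    intro i
    set l := hH.eigenvalues i with hl
    have hv := hH.mulVec_eigenvectorBasis i
    have hne : hH.eigenvectorBasis i ≠ 0 := hH.eigenvectorBasis.orthonormal.ne_zero i
    set v := hH.eigenvectorBasis i with hvdef
    obtain ⟨d, hd⟩ : ∃ d, d = ∑ j, x j * v j := ⟨_, rfl⟩
    have h1 : ∀ j, b * d * x j = (l - a) * v j := by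
      intro j
      have := congrFun hv j
      simp only [Matrix.mulVec, dotProduct, hA, Pi.smul_apply, smul_eq_mul] at this
      have h2 : ∑ t, (a * (if j = t then 1 else 0) + b * (x j * x t)) * v t = a * v j + b * d * x j := by
        simp only [add_mul, Finset.sum_add_distrib, hd, Finset.mul_sum, Finset.sum_mul]
        congr 1
        · simp
        · refine Finset.sum_congr rfl fun t _ => by ring
      rw [h2] at this
      rw [sub_mul, ← this]; ring
    by_cases hla : l = a
    · exact Or.inl hla
    right
    have h3 : c * d = (l - a) * d := by
      have : ∑ j, x j * (b * d * x j) = ∑ j, x j * ((l - a) * v j) :=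
        Finset.sum_congr rfl fun j _ => by rw [h1 j]
      calc c * d = ∑ j, x j * (b * d * x j) := by
            have e : ∑ j, x j * (b * d * x j) = (b * d) * ∑ j, x j * x j := by
              rw [Finset.mul_sum]
              exact Finset.sum_congr rfl fun j _ => by ring
            rw [e, hc, hnorm]; ring
        _ = (l - a) * d := by
            rw [this, hd, Finset.mul_sum]; exact Finset.sum_congr rfl fun j _ => by ring
    have hd0 : d ≠ 0 := by
      intro h0
      apply hne
      ext j
      have := h1 j
      rw [h0] at this
      have h5 : (l - a) * v j = 0 := by rw [← this]; ring
      rcases mul_eq_zero.1 h5 with h | h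
      · exact absurd (sub_eq_zero.1 h) hla
      · simpa using h
    have := mul_right_cancel₀ hd0 h3
    linarith
  have htr : ∑ i, hH.eigenvalues i = N * a + c := by
    have h1 := hH.trace_eq_sum_eigenvalues
    simp only [RCLike.ofReal_real_eq_id, id] at h1
    rw [← h1, Matrix.trace, hc, hnorm]
    simp [hA, Finset.sum_add_distrib, Finset.mul_sum]
  set s := sortedEig A with hs
  have hs' : s = hH.eigenvalues ∘ Tuple.sort hH.eigenvalues := by
    rw [hs, sortedEig, dif_pos hH]
  have hmono : Monotone s := by rw [hs']; exact Tuple.monotone_sort _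
  have hsum : ∑ i, s i = N * a + c := by
    rw [← htr, hs']
    exact Equiv.sum_comp (Tuple.sort hH.eigenvalues) hH.eigenvalues
  have hsv : ∀ i, s i = a ∨ s i = a + c := by
    intro i; rw [hs']; exact hval _
  have hex : ∑ i, (s i - a) = c := by
    rw [Finset.sum_sub_distrib, hsum]; simp
  have hnn : ∀ i, 0 ≤ s i - a := by
    intro i; rcases hsv i with h | h <;> rw [h] <;> linarith
  have hlow : ∀ i : Fin N, (i : ℕ) < N - 1 → s i = a := by
    intro i hi
    rcases hsv i with h | h
    · exact h
    have hl : N - 1 < N := by omega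
    have h1 : s i ≤ s ⟨N - 1, hl⟩ := hmono (by rw [Fin.le_def]; exact hi.le)
    have hne : i ≠ ⟨N - 1, hl⟩ := by
      intro h'; rw [h'] at hi; simp at hi
    have h2 : ∑ j ∈ ({i, ⟨N - 1, hl⟩} : Finset (Fin N)), (s j - a) ≤ ∑ j, (s j - a) :=
      Finset.sum_le_sum_of_subset_of_nonneg (Finset.subset_univ _) fun j _ _ => hnn j
    rw [Finset.sum_pair hne, hex] at h2
    linarith
  have hP : Pplus k A = ∑ i : Fin N, ((s i - a) + if N - k ≤ (i : ℕ) then a else 0) := by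
    rw [Pplus]
    refine Finset.sum_congr rfl fun i _ => ?_
    split_ifs with h
    · ring
    · rw [hlow i (by omega)]; ring
  rw [hP, Finset.sum_add_distrib, hex, add_comm]
  congr 1
  rw [Fin.sum_univ_eq_sum_range (fun i => if N - k ≤ i then a else 0) N, ← Finset.sum_filter]
  have : (Finset.range N).filter (fun i => N - k ≤ i) = Finset.Ico (N - k) N := by
    ext i; simp; omega
  rw [this, Finset.sum_const, Nat.card_Ico, nsmul_eq_mul]
  congr 2
  omega

lemma hessian_radial {N : ℕ} (φ φ1 φ2 : ℝ → ℝ)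
    (h1 : ∀ r, 0 ≤ r → HasDerivAt φ (φ1 r) r) (h2 : ∀ r, 0 ≤ r → HasDerivAt φ1 (φ2 r) r)
    (x : EuclideanSpace ℝ (Fin N)) (i j : Fin N) :
    hessianMatrix (fun y : EuclideanSpace ℝ (Fin N) => φ (‖y‖ ^ 2)) x i j
      = 2 * φ1 (‖x‖ ^ 2) * (if i = j then 1 else 0) + 4 * φ2 (‖x‖ ^ 2) * (x i * x j) := by
  have hn : ∀ y : EuclideanSpace ℝ (Fin N), HasFDerivAt (fun y : EuclideanSpace ℝ (Fin N) => ‖y‖ ^ 2)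
      (2 • (innerSL ℝ y)) y := fun y => (hasStrictFDerivAt_norm_sq y).hasFDerivAt
  have hf : fderiv ℝ (fun y : EuclideanSpace ℝ (Fin N) => φ (‖y‖ ^ 2))
      = fun y => φ1 (‖y‖ ^ 2) • ((2 : ℕ) • (innerSL ℝ y)) := by
    ext1 y
    exact ((h1 _ (by positivity)).comp_hasFDerivAt y (hn y)).fderiv
  rw [hessianMatrix, iteratedFDeriv_two_apply, hf]
  have hL : HasFDerivAt (fun y : EuclideanSpace ℝ (Fin N) => (2 : ℕ) • (innerSL ℝ y))
      ((2 : ℕ) • (innerSL ℝ (E := EuclideanSpace ℝ (Fin N)))) x :=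
    ((2 : ℕ) • (innerSL ℝ (E := EuclideanSpace ℝ (Fin N)))).hasFDerivAt
  have hφ := (h2 _ (by positivity : (0:ℝ) ≤ ‖x‖ ^ 2)).comp_hasFDerivAt x (hn x)
  have := (hφ.smul hL).fderiv
  simp only [Function.comp_def, Pi.smul_def'] at this
  rw [this]
  have hin : (innerSL ℝ (EuclideanSpace.single i (1:ℝ))) (EuclideanSpace.single j (1:ℝ))
      = if i = j then (1:ℝ) else 0 := by
    rw [innerSL_apply_apply, EuclideanSpace.inner_single_left]
    simp [Pi.single_apply]
  simp [EuclideanSpace.inner_single_right, hin]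
  split_ifs <;> ring

lemma exists_nonlin (p : ℝ) (hp : 1 < p) : ∃ f f1 : ℝ → ℝ, (∀ v, HasDerivAt f (f1 v) v) ∧
    Continuous f1 ∧ (∀ v, 0 ≤ f1 v) ∧ (∀ v, f1 v ≤ p) ∧ (∀ v, 0 ≤ f v) ∧ f 0 = 0 ∧
    (∀ v, 0 ≤ v → v ≤ 1 → f v = v ^ p) := by
  have hcont : Continuous (fun v : ℝ => p * (max 0 (min v 1)) ^ (p - 1)) := by
    refine continuous_const.mul (Continuous.rpow_const (by fun_prop) fun x => Or.inr (by linarith))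
  refine ⟨fun v => ∫ t in (0:ℝ)..v, p * (max 0 (min t 1)) ^ (p - 1),
    fun v => p * (max 0 (min v 1)) ^ (p - 1), ?_, hcont, ?_, ?_, ?_, ?_, ?_⟩
  · intro v
    exact intervalIntegral.integral_hasDerivAt_right (hcont.intervalIntegrable _ _)
      (hcont.stronglyMeasurableAtFilter _ _) hcont.continuousAt
  · intro v; positivity
  · intro v
    have : (max 0 (min v 1)) ^ (p - 1) ≤ 1 :=
      Real.rpow_le_one (le_max_left _ _) (by simp) (by linarith)
    nlinarith
  · intro v
    rcases le_total 0 v with h | h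
    · exact intervalIntegral.integral_nonneg h fun t _ => by positivity
    · apply le_of_eq
      symm
      beta_reduce
      rw [intervalIntegral.integral_congr (g := fun _ => (0:ℝ))]
      · simp
      · intro t ht
        rw [Set.uIcc_of_ge h] at ht
        have : max 0 (min t 1) = 0 := max_eq_left ((min_le_left _ _).trans ht.2)
        simp only [this]
        rw [Real.zero_rpow (by linarith), mul_zero]
  · simp
  · intro v h0 h1
    simp only
    rw [intervalIntegral.integral_congr (g := fun t => p * t ^ (p - 1))]
    · rw [intervalIntegral.integral_const_mul, integral_rpow (Or.inl (by linarith))]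
      rw [sub_add_cancel, Real.zero_rpow (by linarith)]
      field_simp
      ring
    · intro t ht
      rw [Set.uIcc_of_le h0] at ht
      simp only
      rw [min_eq_left (ht.2.trans h1), max_eq_right ht.1]

lemma integral_diff_bound (m p l D : ℝ) (hm : 0 ≤ m) (hp : 0 ≤ p) (hD : 0 ≤ D) (hl : 0 < l)
    (f a b : ℝ → ℝ) (hf : Continuous f) (hL : ∀ x y, |f x - f y| ≤ p * |x - y|)
    (ha : Continuous a) (hb : Continuous b) (hab : ∀ s, |a s - b s| ≤ D * Real.cosh (l * s))
    (ρ : ℝ) :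
    |(∫ s in (0:ℝ)..ρ, ∫ t in (0:ℝ)..1, t ^ m * f (a (s * t)))
      - (∫ s in (0:ℝ)..ρ, ∫ t in (0:ℝ)..1, t ^ m * f (b (s * t)))|
      ≤ p * D / l * Real.cosh (l * ρ) := by
  have hc : ∀ c : ℝ → ℝ, Continuous c →
      Continuous (fun z : ℝ × ℝ => z.2 ^ m * f (c (z.1 * z.2))) := by
    intro c hc
    exact (Continuous.rpow_const (by fun_prop) fun x => Or.inr hm).mul (by fun_prop)
  have hc1 : ∀ c : ℝ → ℝ, Continuous c → ∀ s, Continuous (fun t : ℝ => t ^ m * f (c (s * t))) :=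
    fun c h s => (hc c h).comp (by fun_prop : Continuous fun t : ℝ => (s, t))
  have hc2 : ∀ c : ℝ → ℝ, Continuous c →
      Continuous (fun s : ℝ => ∫ t in (0:ℝ)..1, t ^ m * f (c (s * t))) := fun c h =>
    intervalIntegral.continuous_parametric_intervalIntegral_of_continuous'
      (f := fun s t => t ^ m * f (c (s * t))) (hc c h) 0 1
  rw [← intervalIntegral.integral_sub ((hc2 a ha).intervalIntegrable _ _)
    ((hc2 b hb).intervalIntegrable _ _)]
  have key : ∀ s, ‖(∫ t in (0:ℝ)..1, t ^ m * f (a (s * t)))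
      - ∫ t in (0:ℝ)..1, t ^ m * f (b (s * t))‖ ≤ p * D * Real.cosh (l * s) := by
    intro s
    rw [← intervalIntegral.integral_sub ((hc1 a ha s).intervalIntegrable _ _)
      ((hc1 b hb s).intervalIntegrable _ _)]
    have := intervalIntegral.norm_integral_le_of_norm_le_const (a := 0) (b := 1)
      (C := p * D * Real.cosh (l * s))
      (f := fun t => t ^ m * f (a (s * t)) - t ^ m * f (b (s * t))) ?_
    · simpa using this
    intro t ht
    rw [Set.uIoc_of_le zero_le_one] at ht
    rw [← mul_sub, norm_mul, Real.norm_eq_abs, Real.norm_eq_abs, abs_of_nonneg (by have := ht.1.le; positivity)]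
    have h1 : t ^ m ≤ 1 := Real.rpow_le_one ht.1.le ht.2 hm
    have h2 : Real.cosh (l * (s * t)) ≤ Real.cosh (l * s) := by
      rw [Real.cosh_le_cosh, abs_mul, abs_mul, abs_mul, abs_of_pos ht.1]
      have : |s| * t ≤ |s| := by nlinarith [abs_nonneg s, ht.2]
      exact mul_le_mul_of_nonneg_left this (abs_nonneg _)
    calc t ^ m * |f (a (s * t)) - f (b (s * t))| ≤ 1 * |f (a (s * t)) - f (b (s * t))| := by gcongr
      _ ≤ p * |a (s * t) - b (s * t)| := by rw [one_mul]; exact hL _ _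
      _ ≤ p * (D * Real.cosh (l * (s * t))) := by gcongr; exact hab _
      _ ≤ p * (D * Real.cosh (l * s)) := by gcongr
      _ = _ := by ring
  have hcosh : Continuous (fun s => p * D * Real.cosh (l * s)) := by fun_prop
  have h3 := intervalIntegral.norm_integral_le_abs_of_norm_le (μ := MeasureTheory.volume) (a := 0) (b := ρ)
    (Filter.Eventually.of_forall key) (hcosh.intervalIntegrable _ _)
  have h4 : ∫ s in (0:ℝ)..ρ, p * D * Real.cosh (l * s) = p * D / l * Real.sinh (l * ρ) := by
    rw [intervalIntegral.integral_eq_sub_of_hasDerivAt (f := fun s => p * D / l * Real.sinh (l * s))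
      _ (hcosh.intervalIntegrable _ _)]
    · simp
    · intro s _
      have := (((hasDerivAt_id s).const_mul l).sinh).const_mul (p * D / l)
      refine this.congr_deriv ?_
      simp
      field_simp
  rw [h4] at h3
  rw [← Real.norm_eq_abs]
  refine h3.trans ?_
  rw [abs_mul, abs_of_nonneg (by positivity : 0 ≤ p * D / l)]
  gcongr
  rw [abs_le]
  constructor
  · have := Real.exp_pos (l * ρ)
    rw [← Real.cosh_add_sinh] at this; linarith
  · exact (Real.sinh_lt_cosh _).le

lemma exists_fixed (m p : ℝ) (hm : 0 ≤ m) (hp : 0 < p) (f : ℝ → ℝ) (hf : Continuous f)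
    (hL : ∀ x y, |f x - f y| ≤ p * |x - y|) (hf0 : f 0 = 0) :
    ∃ φ : ℝ → ℝ, Continuous φ ∧ ∀ ρ, φ ρ = 1 - (1 / 4) *
      ∫ s in (0:ℝ)..ρ, ∫ t in (0:ℝ)..1, t ^ m * f (φ (s * t)) := by
  let T : (ℝ → ℝ) → ℝ → ℝ := fun φ ρ => 1 - (1 / 4) *
      ∫ s in (0:ℝ)..ρ, ∫ t in (0:ℝ)..1, t ^ m * f (φ (s * t))
  let W : ℝ → ℝ := fun s => Real.cosh (p * s)
  have hW : Continuous W := by fun_prop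
  have hW1 : ∀ s, 1 ≤ W s := fun s => Real.one_le_cosh _
  have hW0 : ∀ s, 0 < W s := fun s => Real.cosh_pos _
  have hTc : ∀ φ, Continuous φ → Continuous (T φ) := by
    intro φ hφ
    have h1 : Continuous (fun z : ℝ × ℝ => z.2 ^ m * f (φ (z.1 * z.2))) :=
      (Continuous.rpow_const (by fun_prop) fun x => Or.inr hm).mul (by fun_prop)
    have h2 : Continuous (fun s : ℝ => ∫ t in (0:ℝ)..1, t ^ m * f (φ (s * t))) :=
      intervalIntegral.continuous_parametric_intervalIntegral_of_continuous'
      (f := fun s t => t ^ m * f (φ (s * t))) h1 0 1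
    exact continuous_const.sub (continuous_const.mul
      (intervalIntegral.continuous_primitive (fun a b => h2.intervalIntegrable a b) 0))
  have hTd : ∀ a b : ℝ → ℝ, Continuous a → Continuous b → ∀ D, 0 ≤ D →
      (∀ s, |a s - b s| ≤ D * W s) → ∀ ρ, |T a ρ - T b ρ| ≤ (1 / 4) * D * W ρ := by
    intro a b ha hb D hD hab ρ
    have := integral_diff_bound m p p D hm hp.le hD hp f a b hf hL ha hb hab ρ
    have e : T a ρ - T b ρ = -((1 / 4) * ((∫ s in (0:ℝ)..ρ, ∫ t in (0:ℝ)..1, t ^ m * f (a (s * t)))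
      - (∫ s in (0:ℝ)..ρ, ∫ t in (0:ℝ)..1, t ^ m * f (b (s * t))))) := by
      simp only [T]; ring
    rw [e, abs_neg, abs_mul, abs_of_pos (by norm_num : (0:ℝ) < 1 / 4), mul_assoc]
    have e2 : p * D / p = D := by field_simp
    rw [e2] at this
    gcongr
  have hT0 : ∀ ρ, T 0 ρ = 1 := by intro ρ; simp [T, hf0]
  have hbd : ∀ (ψ : BoundedContinuousFunction ℝ ℝ) (s : ℝ), |W s * ψ s| ≤ ‖ψ‖ * W s := by
    intro ψ s
    rw [abs_mul, abs_of_pos (hW0 s), mul_comm]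
    have := ψ.norm_coe_le_norm s
    rw [Real.norm_eq_abs] at this
    have := hW0 s
    gcongr
  let S : BoundedContinuousFunction ℝ ℝ → BoundedContinuousFunction ℝ ℝ := fun ψ =>
    BoundedContinuousFunction.ofNormedAddCommGroup (fun ρ => T (fun s => W s * ψ s) ρ / W ρ)
      ((hTc _ (hW.mul ψ.continuous)).div hW fun s => (hW0 s).ne') (1 + (1 / 4) * ‖ψ‖) (by
        intro ρ
        have h1 := hTd (fun s => W s * ψ s) 0 (hW.mul ψ.continuous) continuous_zero ‖ψ‖
          (norm_nonneg _) (by intro s; simpa using hbd ψ s) ρ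
        rw [hT0] at h1
        rw [norm_div, Real.norm_eq_abs, Real.norm_eq_abs, abs_of_pos (hW0 ρ), div_le_iff₀ (hW0 ρ)]
        have h2 := abs_sub_abs_le_abs_sub (T (fun s => W s * ψ s) ρ) 1
        rw [abs_one] at h2
        have := hW1 ρ
        nlinarith)
  have hS : ContractingWith (1 / 4) S := by
    refine ⟨by rw [← NNReal.coe_lt_coe]; norm_num, LipschitzWith.of_dist_le_mul fun ψ χ => ?_⟩
    rw [BoundedContinuousFunction.dist_le (by positivity)]
    intro ρ
    have h1 := hTd (fun s => W s * ψ s) (fun s => W s * χ s) (hW.mul ψ.continuous)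
      (hW.mul χ.continuous) (dist ψ χ) dist_nonneg (by
        intro s
        rw [← mul_sub, abs_mul, abs_of_pos (hW0 s), mul_comm]
        have := ψ.dist_coe_le_dist (g := χ) s
        rw [Real.dist_eq] at this
        have := hW0 s
        gcongr) ρ
    change dist (T (fun s => W s * ψ s) ρ / W ρ) (T (fun s => W s * χ s) ρ / W ρ) ≤ _
    rw [Real.dist_eq, ← sub_div, abs_div, abs_of_pos (hW0 ρ), div_le_iff₀ (hW0 ρ)]
    simpa using h1
  obtain ⟨ψ, hψ⟩ : ∃ ψ, S ψ = ψ := ⟨_, hS.fixedPoint_isFixedPt⟩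
  refine ⟨fun s => W s * ψ s, hW.mul ψ.continuous, fun ρ => ?_⟩
  have h1 : T (fun s => W s * ψ s) ρ / W ρ = ψ ρ := by
    conv_rhs => rw [← hψ]
    rfl
  rw [div_eq_iff (hW0 ρ).ne'] at h1
  change W ρ * ψ ρ = T (fun s => W s * ψ s) ρ
  rw [h1, mul_comm]

lemma lane_emden_ode (m p : ℝ) (hm : 0 ≤ m) (hp : 0 < p) (f f1 : ℝ → ℝ)
    (hf : ∀ v, HasDerivAt f (f1 v) v) (hf1 : Continuous f1) (hf1n : ∀ v, 0 ≤ f1 v)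
    (hf1p : ∀ v, f1 v ≤ p) (hfn : ∀ v, 0 ≤ f v) (hf0 : f 0 = 0) :
    ∃ φ φ1 φ2 : ℝ → ℝ, (∀ r, HasDerivAt φ (φ1 r) r) ∧ (∀ r, HasDerivAt φ1 (φ2 r) r) ∧
      Continuous φ2 ∧ φ 0 = 1 ∧ (∀ r, φ1 r ≤ 0) ∧ (∀ r, 0 ≤ φ2 r) ∧
      (∀ r, 4 * r * φ2 r + 4 * (m + 1) * φ1 r + f (φ r) = 0) ∧
      (∀ r, φ1 r = -(1 / 4) * ∫ t in (0:ℝ)..1, t ^ m * f (φ (r * t))) := by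
  have hfc : Continuous f := continuous_iff_continuousAt.2 fun v => (hf v).continuousAt
  have hL : ∀ x y, |f x - f y| ≤ p * |x - y| := by
    intro x y
    have := Convex.norm_image_sub_le_of_norm_hasDerivWithin_le (f := f) (f' := f1) (s := Set.univ)
      (C := p) (x := y) (y := x) (fun v _ => (hf v).hasDerivWithinAt)
      (fun v _ => by rw [Real.norm_eq_abs, abs_of_nonneg (hf1n v)]; exact hf1p v) convex_univ
      trivial trivial
    simpa using this
  obtain ⟨φ, hφc, hφ⟩ := exists_fixed m p hm hp f hfc hL hf0
  have hpow : Continuous (fun z : ℝ × ℝ => z.2 ^ m) :=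
    Continuous.rpow_const (by fun_prop) fun x => Or.inr hm
  have hFc : Continuous (fun z : ℝ × ℝ => z.2 ^ m * f (φ (z.1 * z.2))) := hpow.mul (by fun_prop)
  have hGc : Continuous (fun s : ℝ => ∫ t in (0:ℝ)..1, t ^ m * f (φ (s * t))) :=
    intervalIntegral.continuous_parametric_intervalIntegral_of_continuous'
      (f := fun s t => t ^ m * f (φ (s * t))) hFc 0 1
  obtain ⟨φ1, hφ1⟩ : ∃ φ1 : ℝ → ℝ, φ1 = fun r =>
    -(1 / 4) * ∫ t in (0:ℝ)..1, t ^ m * f (φ (r * t)) := ⟨_, rfl⟩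
  have hd1 : ∀ r, HasDerivAt φ (φ1 r) r := by
    intro r
    have h1 := intervalIntegral.integral_hasDerivAt_right (hGc.intervalIntegrable 0 r)
      (hGc.stronglyMeasurableAtFilter _ _) hGc.continuousAt
    have h2 := (h1.const_mul (1 / 4)).const_sub 1
    have h3 := h2.congr_of_eventuallyEq (f₁ := φ) (Filter.Eventually.of_forall hφ)
    refine h3.congr_deriv ?_
    rw [hφ1]
    ring
  have hφ1c : Continuous φ1 := by rw [hφ1]; exact continuous_const.mul hGc
  have hF'c : Continuous (fun z : ℝ × ℝ => z.2 ^ m * (f1 (φ (z.1 * z.2)) * (φ1 (z.1 * z.2) * z.2))) :=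
    hpow.mul (by fun_prop)
  have hG'c : Continuous (fun s : ℝ => ∫ t in (0:ℝ)..1, t ^ m * (f1 (φ (s * t)) * (φ1 (s * t) * t))) :=
    intervalIntegral.continuous_parametric_intervalIntegral_of_continuous'
      (f := fun s t => t ^ m * (f1 (φ (s * t)) * (φ1 (s * t) * t))) hF'c 0 1
  have hFt : ∀ s, Continuous (fun t : ℝ => t ^ m * f (φ (s * t))) :=
    fun s => hFc.comp (by fun_prop : Continuous fun t : ℝ => (s, t))
  have hF't : ∀ s, Continuous (fun t : ℝ => t ^ m * (f1 (φ (s * t)) * (φ1 (s * t) * t))) :=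
    fun s => hF'c.comp (by fun_prop : Continuous fun t : ℝ => (s, t))
  have hin1 : ∀ s t, HasDerivAt (fun s => f (φ (s * t))) (f1 (φ (s * t)) * (φ1 (s * t) * t)) s := by
    intro s t
    have e : HasDerivAt (fun s => s * t) t s := by simpa using (hasDerivAt_id s).mul_const t
    exact (hf _).comp s ((hd1 (s * t)).comp s e)
  have hin2 : ∀ s t, HasDerivAt (fun t => f (φ (s * t))) (f1 (φ (s * t)) * (φ1 (s * t) * s)) t := by
    intro s t
    have e : HasDerivAt (fun t => s * t) s t := by simpa using (hasDerivAt_id t).const_mul s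
    exact (hf _).comp t ((hd1 (s * t)).comp t e)
  have hGd : ∀ r, HasDerivAt (fun s : ℝ => ∫ t in (0:ℝ)..1, t ^ m * f (φ (s * t)))
      (∫ t in (0:ℝ)..1, t ^ m * (f1 (φ (r * t)) * (φ1 (r * t) * t))) r := by
    intro r
    obtain ⟨C, hC⟩ := ((isCompact_closedBall r 1).prod (isCompact_Icc (a := (0:ℝ)) (b := 1))).exists_bound_of_continuousOn
      hF'c.continuousOn
    refine (intervalIntegral.hasDerivAt_integral_of_dominated_loc_of_deriv_le
      (F := fun s t => t ^ m * f (φ (s * t)))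
      (F' := fun s t => t ^ m * (f1 (φ (s * t)) * (φ1 (s * t) * t)))
      (s := Metric.closedBall r 1) (bound := fun _ => C)
      (Metric.closedBall_mem_nhds r one_pos)
      (Filter.Eventually.of_forall fun s => (hFt s).aestronglyMeasurable)
      ((hFt r).intervalIntegrable _ _) (hF't r).aestronglyMeasurable ?_
      (continuous_const.intervalIntegrable _ _) ?_).2
    · refine Filter.Eventually.of_forall fun t ht s hs => ?_
      rw [Set.uIoc_of_le zero_le_one] at ht
      exact hC (s, t) ⟨hs, ht.1.le, ht.2⟩
    · refine Filter.Eventually.of_forall fun t ht s hs => ?_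
      exact (hin1 s t).const_mul _
  have hn1 : ∀ r, φ1 r ≤ 0 := by
    intro r
    have : 0 ≤ ∫ t in (0:ℝ)..1, t ^ m * f (φ (r * t)) :=
      intervalIntegral.integral_nonneg zero_le_one fun t ht =>
        mul_nonneg (Real.rpow_nonneg ht.1 _) (hfn _)
    rw [hφ1]; simp only; linarith
  refine ⟨φ, φ1, fun r => -(1 / 4) * ∫ t in (0:ℝ)..1, t ^ m * (f1 (φ (r * t)) * (φ1 (r * t) * t)),
    hd1, ?_, continuous_const.mul hG'c, ?_, hn1, ?_, ?_, ?_⟩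
  · intro r
    have := (hGd r).const_mul (-(1 / 4))
    conv => arg 1; rw [hφ1]
    exact this
  · rw [hφ]; simp
  · intro r
    have : 0 ≤ ∫ t in (0:ℝ)..1, -(t ^ m * (f1 (φ (r * t)) * (φ1 (r * t) * t))) :=
      intervalIntegral.integral_nonneg zero_le_one fun t ht => by
        have h1 := Real.rpow_nonneg ht.1 m
        have h2 := mul_nonneg (hf1n (φ (r * t))) (mul_nonneg (neg_nonneg.2 (hn1 (r * t))) ht.1)
        nlinarith [mul_nonneg h1 h2]
    rw [intervalIntegral.integral_neg] at this
    simp only; linarith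
  · intro r
    have hmm : ∀ t : ℝ, 0 ≤ t → t ^ (m + 1) = t ^ m * t := fun t ht =>
      Real.rpow_add_one' ht (by linarith)
    have hI : ∫ t in (0:ℝ)..1, ((m + 1) * (t ^ m * f (φ (r * t)))
        + r * (t ^ m * (f1 (φ (r * t)) * (φ1 (r * t) * t)))) = f (φ r) := by
      rw [intervalIntegral.integral_eq_sub_of_hasDerivAt
        (f := fun t => t ^ (m + 1) * f (φ (r * t)))]
      · simp [Real.zero_rpow (by linarith : m + 1 ≠ 0)]
      · intro t ht
        rw [Set.uIcc_of_le zero_le_one] at ht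
        have := (Real.hasDerivAt_rpow_const (x := t) (p := m + 1) (Or.inr (by linarith))).mul (hin2 r t)
        refine this.congr_deriv ?_
        rw [hmm t ht.1, add_sub_cancel_right]
        ring
      · exact ((continuous_const.mul (hFt r)).add (continuous_const.mul (hF't r))).intervalIntegrable _ _
    rw [intervalIntegral.integral_add
      (f := fun t => (m + 1) * (t ^ m * f (φ (r * t))))
      (g := fun t => r * (t ^ m * (f1 (φ (r * t)) * (φ1 (r * t) * t))))
      ((continuous_const.mul (hFt r)).intervalIntegrable _ _)
      ((continuous_const.mul (hF't r)).intervalIntegrable _ _),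
      intervalIntegral.integral_const_mul, intervalIntegral.integral_const_mul] at hI
    have e1 : φ1 r = -(1 / 4) * ∫ t in (0:ℝ)..1, t ^ m * f (φ (r * t)) := by rw [hφ1]
    rw [← hI, e1]
    ring
  · intro r; rw [hφ1]

lemma lane_emden_pos (κ p : ℝ) (hκ : 1 < κ) (hp : 1 < p) (hκp : 2 * κ ≤ (κ - 1) * (p + 1))
    (f φ φ1 φ2 : ℝ → ℝ) (hfv : ∀ v, 0 ≤ v → v ≤ 1 → f v = v ^ p) (hfc : Continuous f)
    (h1 : ∀ r, HasDerivAt φ (φ1 r) r) (h2 : ∀ r, HasDerivAt φ1 (φ2 r) r)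
    (h0 : φ 0 = 1) (hn : ∀ r, φ1 r ≤ 0)
    (hode : ∀ r, 4 * r * φ2 r + 4 * κ * φ1 r + f (φ r) = 0)
    (hint : ∀ r, φ1 r = -(1 / 4) * ∫ t in (0:ℝ)..1, t ^ (κ - 1) * f (φ (r * t))) :
    ∀ r, 0 ≤ r → 0 < φ r ∧ φ r ≤ 1 := by
  have hφc : Continuous φ := continuous_iff_continuousAt.2 fun v => (h1 v).continuousAt
  have hφ1c : Continuous φ1 := continuous_iff_continuousAt.2 fun v => (h2 v).continuousAt
  have hanti : Antitone φ := antitone_of_hasDerivAt_nonpos h1 hn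
  have hle : ∀ r, 0 ≤ r → φ r ≤ 1 := fun r hr => h0 ▸ hanti hr
  by_contra! hcon
  obtain ⟨r0, hr0, hr0'⟩ := hcon
  have hr00 : φ r0 ≤ 0 := by
    by_contra! h
    exact absurd (hle r0 hr0) (not_le.2 (hr0' h))
  obtain ⟨R, hR, hRz⟩ : ∃ R ∈ Set.Icc 0 r0, φ R = 0 :=
    intermediate_value_Icc' hr0 hφc.continuousOn ⟨hr00, by rw [h0]; exact zero_le_one⟩
  set S := {r | 0 ≤ r ∧ φ r ≤ 0} with hS
  have hSc : IsClosed S := (isClosed_le continuous_const continuous_id).inter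
    (isClosed_le hφc continuous_const)
  have hSb : BddBelow S := ⟨0, fun r hr => hr.1⟩
  have hm : sInf S ∈ S := hSc.csInf_mem ⟨r0, hr0, hr00⟩ hSb
  clear hRz hR R
  set R := sInf S with hRdef
  have hlt : ∀ r, 0 ≤ r → r < R → 0 < φ r := by
    intro r hr hrR
    by_contra! h
    exact absurd (csInf_le hSb (show r ∈ S from ⟨hr, h⟩)) (not_le.2 hrR)
  have hR0 : 0 < R := by
    rcases hm.1.lt_or_eq with h | h
    · exact h
    · have := hm.2; rw [← h, h0] at this; linarith
  have hRz : φ R = 0 := by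
    refine le_antisymm hm.2 ?_
    have : Set.Icc 0 R ⊆ {r | 0 ≤ φ r} := by
      rw [← closure_Ico hR0.ne]
      exact closure_minimal (fun r hr => (hlt r hr.1 hr.2).le) (isClosed_le continuous_const hφc)
    exact this ⟨hR0.le, le_rfl⟩
  have hneg : φ1 R < 0 := by
    have : 0 < ∫ t in (0:ℝ)..1, t ^ (κ - 1) * f (φ (R * t)) := by
      refine intervalIntegral.intervalIntegral_pos_of_pos_on ?_ ?_ zero_lt_one
      · refine Continuous.intervalIntegrable ?_ _ _
        exact (Continuous.rpow_const continuous_id fun x => Or.inr (by linarith)).mul (by fun_prop)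
      · intro t ht
        have hRt : 0 ≤ R * t := mul_nonneg hR0.le ht.1.le
        have hp1 : 0 < φ (R * t) := hlt _ hRt (by nlinarith [ht.2])
        rw [hfv _ hp1.le (hle _ hRt)]
        have := ht.1
        positivity
    rw [hint]; linarith
  let E : ℝ → ℝ := fun r => r ^ κ * (2 * r * φ1 r ^ 2 + φ r ^ (p + 1) / (p + 1)
    + 2 * (κ - 1) * (φ r * φ1 r))
  have hEd : ∀ r, HasDerivAt E (κ * r ^ (κ - 1) * (2 * r * φ1 r ^ 2 + φ r ^ (p + 1) / (p + 1)
      + 2 * (κ - 1) * (φ r * φ1 r)) + r ^ κ * (2 * φ1 r ^ 2 + 2 * r * (2 * φ1 r * φ2 r)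
      + φ r ^ p * φ1 r + 2 * (κ - 1) * (φ1 r * φ1 r + φ r * φ2 r))) r := by
    intro r
    have a1 : HasDerivAt (fun r : ℝ => r ^ κ) (κ * r ^ (κ - 1)) r :=
      Real.hasDerivAt_rpow_const (Or.inr hκ.le)
    have a2 : HasDerivAt (fun r : ℝ => 2 * r * φ1 r ^ 2) (2 * φ1 r ^ 2 + 2 * r * (2 * φ1 r * φ2 r)) r := by
      have b1 : HasDerivAt (fun r : ℝ => 2 * r) 2 r := by simpa using (hasDerivAt_id r).const_mul 2
      have := b1.mul ((h2 r).pow 2)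
      refine this.congr_deriv ?_
      simp
    have a3 : HasDerivAt (fun r : ℝ => φ r ^ (p + 1) / (p + 1)) (φ r ^ p * φ1 r) r := by
      have := ((h1 r).rpow_const (p := p + 1) (Or.inr (by linarith))).div_const (p + 1)
      refine this.congr_deriv ?_
      rw [add_sub_cancel_right]
      have : p + 1 ≠ 0 := by linarith
      field_simp
    have a4 := ((h1 r).mul (h2 r)).const_mul (2 * (κ - 1))
    exact a1.mul ((a2.add a3).add a4)
  have hEanti : AntitoneOn E (Set.Icc 0 R) := by
    refine antitoneOn_of_hasDerivWithinAt_nonpos (convex_Icc 0 R)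
      (fun r _ => (hEd r).continuousAt.continuousWithinAt)
      (fun r _ => (hEd r).hasDerivWithinAt) ?_
    intro r hr
    rw [interior_Icc] at hr
    have hr0 := hr.1
    have hφ0 : 0 < φ r := hlt r hr.1.le hr.2
    have e1 : r ^ κ = r ^ (κ - 1) * r := by
      rw [← Real.rpow_add_one hr0.ne', sub_add_cancel]
    have e2 : φ r ^ (p + 1) = φ r ^ p * φ r := Real.rpow_add_one hφ0.ne' p
    have e3 := hode r
    rw [hfv _ hφ0.le (hle r hr0.le)] at e3
    have hA : 0 < r ^ (κ - 1) := Real.rpow_pos_of_pos hr0 _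
    have hB : 0 < φ r ^ p := Real.rpow_pos_of_pos hφ0 _
    rw [e1, e2]
    generalize r ^ (κ - 1) = A at *
    generalize φ r ^ p = B at *
    have hp1 : 0 < p + 1 := by linarith
    have e4 : 4 * r * φ2 r = - 4 * κ * φ1 r - B := by linarith
    have key : κ * A * (2 * r * φ1 r ^ 2 + B * φ r / (p + 1)
      + 2 * (κ - 1) * (φ r * φ1 r)) + A * r * (2 * φ1 r ^ 2 + 2 * r * (2 * φ1 r * φ2 r)
      + B * φ1 r + 2 * (κ - 1) * (φ1 r * φ1 r + φ r * φ2 r))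
      = A * (B * φ r) * (κ / (p + 1) - (κ - 1) / 2) := by
      linear_combination (A * r * φ1 r + A * (κ - 1) / 2 * φ r) * e4
    rw [key]
    refine mul_nonpos_of_nonneg_of_nonpos (by positivity) ?_
    rw [sub_nonpos, div_le_div_iff₀ hp1 two_pos]
    linarith
  have hER : E R ≤ E 0 := hEanti ⟨le_rfl, hR0.le⟩ ⟨hR0.le, le_rfl⟩ hR0.le
  have hE0 : E 0 = 0 := by simp [E, Real.zero_rpow (by linarith : κ ≠ 0)]
  have hERp : 0 < E R := by
    simp only [E, hRz]
    rw [Real.zero_rpow (by linarith)]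
    have : 0 < φ1 R ^ 2 := by nlinarith
    have : 0 < R ^ κ := by positivity
    simp only [zero_div, zero_mul, mul_zero, add_zero]
    positivity
  linarith

lemma radial_solution {N k : ℕ} (hk : 0 < k) (hkN : k < N) (p : ℝ) (φ φ1 φ2 : ℝ → ℝ)
    (h1 : ∀ r, 0 ≤ r → HasDerivAt φ (φ1 r) r) (h2 : ∀ r, 0 ≤ r → HasDerivAt φ1 (φ2 r) r)
    (hn : ∀ r, 0 ≤ r → 0 ≤ φ2 r)
    (hode : ∀ r, 0 ≤ r → 4 * r * φ2 r + 2 * k * φ1 r + φ r ^ p = 0)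
    (x : EuclideanSpace ℝ (Fin N)) :
    Pplus k (hessianMatrix (fun y : EuclideanSpace ℝ (Fin N) => φ (‖y‖ ^ 2)) x)
      + φ (‖x‖ ^ 2) ^ p = 0 := by
  have hx : 0 ≤ ‖x‖ ^ 2 := by positivity
  rw [pplus_rank_one hk hkN (2 * φ1 (‖x‖ ^ 2)) (4 * φ2 (‖x‖ ^ 2)) (by linarith [hn _ hx]) x _
    (hessian_radial φ φ1 φ2 h1 h2 x)]
  linarith [hode _ hx]

lemma exists_part (N k : ℕ) (hk2 : 2 < k) (hkN : k < N) (p : ℝ)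
    (hp : ((k : ℝ) + 2) / ((k : ℝ) - 2) ≤ p) :
    ∃ u : EuclideanSpace ℝ (Fin N) → ℝ, ContDiff ℝ 2 u ∧ (∀ x, 0 < u x) ∧
      ∀ x, Pplus k (hessianMatrix u x) + u x ^ p = 0 := by
  have hk : (3:ℝ) ≤ k := by exact_mod_cast hk2
  rw [div_le_iff₀ (by linarith)] at hp
  have hp1 : 1 < p := by
    by_contra! h
    nlinarith
  obtain ⟨f, f1, hf, hf1, hf1n, hf1p, hfn, hf0, hfv⟩ := exists_nonlin p hp1
  obtain ⟨φ, φ1, φ2, h1, h2, hc, h0, hn1, hn2, hode, hint⟩ :=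
    lane_emden_ode ((k : ℝ) / 2 - 1) p (by linarith) (by linarith) f f1 hf hf1 hf1n hf1p hfn hf0
  have hode' : ∀ r, 4 * r * φ2 r + 4 * ((k : ℝ) / 2) * φ1 r + f (φ r) = 0 := fun r => by
    rw [← hode r]; ring
  have hpos := lane_emden_pos ((k : ℝ) / 2) p (by linarith) hp1 (by linarith) f φ φ1 φ2 hfv
    (continuous_iff_continuousAt.2 fun v => (hf v).continuousAt) h1 h2 h0 hn1 hode' hint
  have hC : ContDiff ℝ 2 φ := by
    have d1 : deriv φ = φ1 := funext fun r => (h1 r).deriv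
    have d2 : deriv φ1 = φ2 := funext fun r => (h2 r).deriv
    have c1 : ContDiff ℝ 1 φ1 := by
      rw [contDiff_one_iff_deriv, d2]
      exact ⟨fun r => (h2 r).differentiableAt, hc⟩
    rw [show (2 : WithTop ℕ∞) = 1 + 1 by norm_num, contDiff_succ_iff_deriv, d1]
    exact ⟨fun r => (h1 r).differentiableAt, by simp, c1⟩
  refine ⟨fun x => φ (‖x‖ ^ 2), hC.comp (contDiff_norm_sq ℝ), fun x => (hpos _ (by positivity)).1, ?_⟩
  refine radial_solution (by omega) hkN p φ φ1 φ2 (fun r _ => h1 r) (fun r _ => h2 r)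
    (fun r _ => hn2 r) ?_
  intro r hr
  have := hode' r
  rw [hfv _ (hpos r hr).1.le (hpos r hr).2] at this
  linarith

lemma explicit_part (N k : ℕ) (hk2 : 2 < k) (hkN : k < N) (p : ℝ)
    (hp : p = ((k : ℝ) + 2) / ((k : ℝ) - 2)) (μ : ℝ) (hμ : 0 < μ) (C : ℝ)
    (hC : C = ((k : ℝ) * ((k : ℝ) - 2) * μ) ^ (((k : ℝ) - 2) / 4))
    (u : EuclideanSpace ℝ (Fin N) → ℝ)
    (hu : u = fun x => C * (μ + ‖x‖ ^ 2) ^ (-(((k : ℝ) - 2) / 2))) :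
      ContDiff ℝ 2 u ∧ (∀ x, 0 < u x) ∧
        ∀ x, Pplus k (hessianMatrix u x) + u x ^ p = 0 := by
  have hk : (3:ℝ) ≤ k := by exact_mod_cast hk2
  have hk' : (0:ℝ) < (k:ℝ) - 2 := by linarith
  have hM : 0 < (k : ℝ) * ((k : ℝ) - 2) * μ := by positivity
  have hCp : 0 < C := by rw [hC]; positivity
  obtain ⟨a, ha⟩ : ∃ a, a = ((k : ℝ) - 2) / 2 := ⟨_, rfl⟩
  have ha0 : 0 < a := by rw [ha]; linarith
  have hka : (k : ℝ) = 2 * a + 2 := by rw [ha]; ring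
  rw [← ha] at hu
  subst hu
  refine ⟨?_, fun x => by positivity, ?_⟩
  · refine contDiff_const.mul (ContDiff.rpow_const_of_ne (contDiff_const.add (contDiff_norm_sq ℝ)) ?_)
    intro x; positivity
  have hd : ∀ (q r : ℝ), 0 ≤ r → HasDerivAt (fun r : ℝ => (μ + r) ^ q) (q * (μ + r) ^ (q - 1)) r := by
    intro q r hr
    have := ((hasDerivAt_id r).const_add μ).rpow_const (p := q) (Or.inl (by simp; linarith))
    refine this.congr_deriv ?_
    simp
  refine radial_solution (by omega) hkN p (fun r => C * (μ + r) ^ (-a))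
    (fun r => C * (-a * (μ + r) ^ (-a - 1)))
    (fun r => C * (-a * ((-a - 1) * (μ + r) ^ (-a - 1 - 1)))) (fun r hr => (hd _ r hr).const_mul C)
    (fun r hr => ((hd _ r hr).const_mul (-a)).const_mul C) ?_ ?_
  · intro r hr
    have : 0 ≤ C * (a * ((a + 1) * (μ + r) ^ (-a - 1 - 1))) := by positivity
    linarith
  · intro r hr
    have hs : 0 < μ + r := by linarith
    have hpa : a * p = a + 2 := by
      rw [hp, hka]
      have e : 2 * a + 2 - 2 = 2 * a := by ring
      rw [e]
      field_simp
      ring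
    have e1 : (C * (μ + r) ^ (-a)) ^ p = C ^ p * (μ + r) ^ (-a - 1 - 1) := by
      rw [Real.mul_rpow hCp.le (by positivity), ← Real.rpow_mul hs.le]
      congr 2
      linarith
    have e2 : C ^ p = C * (4 * a * (a + 1) * μ) := by
      have hM' : (k : ℝ) * ((k : ℝ) - 2) * μ = 4 * a * (a + 1) * μ := by rw [hka]; ring
      have hq : ((k : ℝ) - 2) / 4 = a / 2 := by rw [hka]; ring
      rw [hM', hq] at hC
      rw [hM'] at hM
      rw [hC, ← Real.rpow_mul hM.le, ← Real.rpow_add_one hM.ne']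
      congr 1
      linarith
    have e3 : (μ + r) ^ (-a - 1) = (μ + r) ^ (-a - 1 - 1) * (μ + r) := by
      rw [← Real.rpow_add_one hs.ne', sub_add_cancel]
    rw [e1, e2, e3, hka]
    ring

theorem statement8 (N k : ℕ) (hk2 : 2 < k) (hkN : k < N) (p : ℝ)
    (hp : ((k : ℝ) + 2) / ((k : ℝ) - 2) ≤ p) :
    (∃ u : EuclideanSpace ℝ (Fin N) → ℝ, ContDiff ℝ 2 u ∧ (∀ x, 0 < u x) ∧
      ∀ x, Pplus k (hessianMatrix u x) + u x ^ p = 0) ∧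
    (p = ((k : ℝ) + 2) / ((k : ℝ) - 2) → ∀ μ : ℝ, 0 < μ →
      let C : ℝ := ((k : ℝ) * ((k : ℝ) - 2) * μ) ^ (((k : ℝ) - 2) / 4)
      let u : EuclideanSpace ℝ (Fin N) → ℝ :=
        fun x => C * (μ + ‖x‖ ^ 2) ^ (-(((k : ℝ) - 2) / 2))
      ContDiff ℝ 2 u ∧ (∀ x, 0 < u x) ∧
        ∀ x, Pplus k (hessianMatrix u x) + u x ^ p = 0) := by
  exact ⟨exists_part N k hk2 hkN p hp, fun h μ hμ =>
    explicit_part N k hk2 hkN p h μ hμ _ rfl _ rfl⟩
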